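/- For every integer m ≥ 4 there exist binary sequences a, b : {0,…,N−1} → {1,−1} of length N = 2^{m−1}+2 such that ρ_a(τ)+ρ_b(τ) = 0 for every integer τ with 1 ≤ τ ≤ 2^{m−2}+2^{m−3}, and moreover ρ_a(τ)+ρ_b(τ) ∈ {0, 4, −4} for every τ with 2^{m−2}+2^{m−3} < τ ≤ N−1. That is, there exists an even-length binary Z-complementary pair of length 2^{m−1}+2 with zero correlation zone width 2^{m−2}+2^{m−3}+1 whose out-of-zone aperiodic autocorrelation sums have magnitude exactly 4 whenever nonzero. -/

import Mathlib

open Finset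

/-- The `j`-th binary digit of the integer `i`, as an element of `ZMod 2`. -/
def bitZ (i j : ℕ) : ZMod 2 := ((i / 2 ^ j) % 2 : ℕ)

/-- The generalized Boolean function `ζ^d` of the construction (in variables `x_0,…,x_{m-3}`). -/
def zeta (m : ℕ) (π : ℕ → ℕ) (d : ZMod 2) (x : ℕ → ZMod 2) : ZMod 2 :=
  (∑ α ∈ Finset.range (m - 3), x (π α) * x (π (α + 1))) + d * x (π (m - 3))

/-- The generalized Boolean function `η^d` of the construction. -/
def eta (m : ℕ) (π : ℕ → ℕ) (d : ZMod 2) (x : ℕ → ZMod 2) : ZMod 2 :=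
  (∑ α ∈ Finset.range (m - 3), (1 - x (π α)) * (1 - x (π (α + 1))))
    + (1 - d) * x (π (m - 3))

/-- The generalized Boolean function `g^d` of the construction (in `m` variables). -/
def gbf (m : ℕ) (π : ℕ → ℕ) (e f : ℕ → ZMod 2) (d : ZMod 2) (x : ℕ → ZMod 2) : ZMod 2 :=
  x (m - 2) * (1 - x (m - 1)) * zeta m π d x
    + (1 - x (m - 2)) * x (m - 1) * eta m π d x
    + d * (1 - x (m - 2)) * (1 - x (m - 1))
    + x (m - 2) * x (m - 1)
    + (∑ i ∈ Finset.range (m - 2), e i * x i)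
    + (∑ i ∈ Finset.range (m - 2), f i * (1 - x i))

/-- The ±1 sequence `Ψ(F)` associated with a generalized Boolean function:
its `i`-th entry is `(-1)^{F(r_{i,0}, r_{i,1}, …)}`. -/
def Psi (F : (ℕ → ZMod 2) → ZMod 2) (i : ℕ) : ℤ := (-1) ^ (F (bitZ i)).val

/-- The truncated sequence `Ψ_L(F)`, obtained by deleting the first (and last) `L`
entries of `Ψ(F)`: its `k`-th entry is the `(L+k)`-th entry of `Ψ(F)`. -/
def PsiT (F : (ℕ → ZMod 2) → ZMod 2) (L : ℕ) (k : ℕ) : ℤ := Psi F (L + k)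

/-- Aperiodic autocorrelation of a length-`N` sequence `a` at time shift `τ`. -/
def rho (N : ℕ) (a : ℕ → ℤ) (τ : ℕ) : ℤ :=
  ∑ k ∈ Finset.range (N - τ), a k * a (k + τ)

open Polynomial in
/-- Generating polynomial. -/
noncomputable def gP (N : ℕ) (a : ℕ → ℤ) : ℤ[X] := ∑ k ∈ Finset.range N, C (a k) * X ^ k

open Polynomial in
/-- Reversed generating polynomial (times `X`). -/
noncomputable def rP (N : ℕ) (a : ℕ → ℤ) : ℤ[X] := ∑ k ∈ Finset.range N, C (a k) * X ^ (N - k)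

/-- Concatenation. -/
def cat (N : ℕ) (a b : ℕ → ℤ) (k : ℕ) : ℤ := if k < N then a k else b (k - N)

/-- Reversal. -/
def revS (N : ℕ) (a : ℕ → ℤ) (k : ℕ) : ℤ := a (N - 1 - k)

/-- Entries are signs. -/
def IsSign (a : ℕ → ℤ) : Prop := ∀ k, a k = 1 ∨ a k = -1

theorem IsSign.cat {a b : ℕ → ℤ} (N : ℕ) (ha : IsSign a) (hb : IsSign b) : IsSign (cat N a b) := by
  intro k
  unfold _root_.cat
  split_ifs
  · exact ha _
  · exact hb _

theorem IsSign.neg {a : ℕ → ℤ} (ha : IsSign a) : IsSign (-a) := by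
  intro k
  rcases ha k with h | h <;> simp [h]

open Polynomial in
theorem gP_cat (N M : ℕ) (a b : ℕ → ℤ) : gP (N + M) (cat N a b) = gP N a + X ^ N * gP M b := by
  unfold gP
  rw [Finset.sum_range_add, Finset.mul_sum]
  congr 1
  · refine Finset.sum_congr rfl fun k hk => ?_
    simp [cat, Finset.mem_range.1 hk]
  · refine Finset.sum_congr rfl fun k hk => ?_
    simp [cat]
    ring

open Polynomial in
theorem rP_cat (N M : ℕ) (a b : ℕ → ℤ) : rP (N + M) (cat N a b) = X ^ M * rP N a + rP M b := by
  unfold rP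
  rw [Finset.sum_range_add, Finset.mul_sum]
  congr 1
  · refine Finset.sum_congr rfl fun k hk => ?_
    have h := Finset.mem_range.1 hk
    have e : N + M - k = M + (N - k) := by omega
    simp only [cat, h, if_true, e, pow_add]
    ring
  · refine Finset.sum_congr rfl fun k hk => ?_
    have e : N + M - (N + k) = M - k := by omega
    simp [cat, e]

theorem gP_neg (N : ℕ) (a : ℕ → ℤ) : gP N (-a) = - gP N a := by
  simp [gP]

theorem rP_neg (N : ℕ) (a : ℕ → ℤ) : rP N (-a) = - rP N a := by
  simp [rP]

open Polynomial in
theorem gP_rev (N : ℕ) (a : ℕ → ℤ) : X * gP N (revS N a) = rP N a := by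
  unfold gP rP
  rw [← Finset.sum_range_reflect, Finset.mul_sum]
  refine Finset.sum_congr rfl fun k hk => ?_
  have h := Finset.mem_range.1 hk
  have e : N - k = (N - 1 - k) + 1 := by omega
  have e2 : N - 1 - (N - 1 - k) = k := by omega
  rw [e, revS, e2]
  ring

open Polynomial in
theorem rP_rev (N : ℕ) (a : ℕ → ℤ) : rP N (revS N a) = X * gP N a := by
  unfold gP rP
  rw [← Finset.sum_range_reflect, Finset.mul_sum]
  refine Finset.sum_congr rfl fun k hk => ?_
  have h := Finset.mem_range.1 hk
  have e : N - (N - 1 - k) = k + 1 := by omega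
  have e2 : N - 1 - (N - 1 - k) = k := by omega
  rw [e, revS, e2]
  ring

open Polynomial in
theorem coeff_rho (N : ℕ) (a : ℕ → ℤ) (τ : ℕ) :
    (gP N a * rP N a).coeff (N + τ) = rho N a τ := by
  unfold gP rP rho
  rw [Finset.sum_mul_sum, Finset.sum_comm]
  simp only [finsetSum_coeff]
  have key : ∀ j ∈ Finset.range N, ∑ i ∈ Finset.range N,
      (C (a i) * X ^ i * (C (a j) * X ^ (N - j)) : ℤ[X]).coeff (N + τ)
      = if j < N - τ then a j * a (j + τ) else 0 := by
    intro j hj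
    have hj := Finset.mem_range.1 hj
    have h1 : ∀ i ∈ Finset.range N,
      (C (a i) * X ^ i * (C (a j) * X ^ (N - j)) : ℤ[X]).coeff (N + τ)
        = if j + τ = i then a j * a i else 0 := by
      intro i _
      have e : (C (a i) * X ^ i * (C (a j) * X ^ (N - j)) : ℤ[X])
          = C (a j * a i) * X ^ (i + (N - j)) := by
        rw [C_mul, pow_add]; ring
      rw [e, coeff_C_mul_X_pow]
      congr 1
      apply propext
      omega
    rw [Finset.sum_congr rfl h1, Finset.sum_ite_eq]
    congr 1
    apply propext
    rw [Finset.mem_range]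
    omega
  rw [Finset.sum_congr rfl key, ← Finset.sum_filter]
  refine Finset.sum_congr ?_ fun _ _ => rfl
  ext j
  simp only [Finset.mem_filter, Finset.mem_range]
  omega

open Polynomial in
theorem golay_exists (n : ℕ) : ∃ p q : ℕ → ℤ, IsSign p ∧ IsSign q ∧ ∃ c : ℤ,
    gP (2 ^ n) p * rP (2 ^ n) p + gP (2 ^ n) q * rP (2 ^ n) q = C c * X ^ (2 ^ n) := by
  induction n with
  | zero =>
    refine ⟨1, 1, fun _ => Or.inl rfl, fun _ => Or.inl rfl, 2, ?_⟩
    simp [gP, rP]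
    ring
  | succ n ih =>
    obtain ⟨p, q, hp, hq, c, h⟩ := ih
    refine ⟨cat (2 ^ n) p q, cat (2 ^ n) p (-q), hp.cat _ hq, hp.cat _ hq.neg, 2 * c, ?_⟩
    rw [pow_succ, mul_two, gP_cat, rP_cat, gP_cat, rP_cat, gP_neg, rP_neg, C_mul, pow_add]
    simp only [eq_intCast, Int.cast_ofNat] at h ⊢
    linear_combination (2 * X ^ 2 ^ n) * h

open Polynomial in
theorem coeff_gP (N : ℕ) (a : ℕ → ℤ) (j : ℕ) (hj : N ≤ j) : (gP N a).coeff j = 0 := by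
  unfold gP
  rw [finsetSum_coeff]
  refine Finset.sum_eq_zero fun i hi => ?_
  have := Finset.mem_range.1 hi
  rw [coeff_C_mul_X_pow, if_neg (by omega)]

open Polynomial in
theorem coeff_rP (N : ℕ) (a : ℕ → ℤ) (j : ℕ) :
    (rP N a).coeff j = if 1 ≤ j ∧ j ≤ N then a (N - j) else 0 := by
  unfold rP
  rw [finsetSum_coeff]
  simp only [coeff_C_mul_X_pow]
  split_ifs with h
  · rw [Finset.sum_eq_single (N - j)]
    · rw [if_pos (by omega)]
    · intro i hi hne
      have := Finset.mem_range.1 hi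
      rw [if_neg (by omega)]
    · intro hn
      exact absurd (Finset.mem_range.2 (by omega)) hn
  · refine Finset.sum_eq_zero fun i hi => ?_
    have := Finset.mem_range.1 hi
    rw [if_neg (by omega)]

open Polynomial in
theorem ebzcp_core (H : ℕ) (p q : ℕ → ℤ) (hp : IsSign p) (hq : IsSign q) (c : ℤ)
    (h : gP H p * rP H p + gP H q * rP H q = C c * X ^ H) :
    ∃ a b : ℕ → ℤ, IsSign a ∧ IsSign b ∧ ∀ τ, 1 ≤ τ → τ ≤ 4 * H + 1 →
      rho (4 * H + 2) a τ + rho (4 * H + 2) b τ =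
        if 3 * H + 1 ≤ τ ∧ τ ≤ 4 * H then -4 * p (4 * H - τ) else 0 := by
  have h1 : IsSign 1 := fun _ => Or.inl rfl
  obtain ⟨u, hu⟩ : ∃ u, u = cat H p q := ⟨_, rfl⟩
  obtain ⟨v, hv⟩ : ∃ v, v = cat H p (-q) := ⟨_, rfl⟩
  have su : IsSign u := hu ▸ hp.cat _ hq
  have sv : IsSign v := hv ▸ hp.cat _ hq.neg
  have gu : gP (H + H) u = gP H p + X ^ H * gP H q := by rw [hu, gP_cat]
  have ru : rP (H + H) u = X ^ H * rP H p + rP H q := by rw [hu, rP_cat]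
  have gv : gP (H + H) v = gP H p - X ^ H * gP H q := by rw [hv, gP_cat, gP_neg]; ring
  have rv : rP (H + H) v = X ^ H * rP H p - rP H q := by rw [hv, rP_cat, rP_neg]; ring
  obtain ⟨a, ha⟩ : ∃ a, a = cat 1 1 (cat (H + H) u (cat (H + H) (-revS (H + H) v) (-1))) := ⟨_, rfl⟩
  obtain ⟨b, hb⟩ : ∃ b, b = cat 1 (-1) (cat (H + H) v (cat (H + H) (revS (H + H) u) (-1))) :=
    ⟨_, rfl⟩
  have hN : 4 * H + 2 = 1 + ((H + H) + ((H + H) + 1)) := by ring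
  have g1 : gP 1 1 = 1 := by simp [gP]
  have r1 : rP 1 1 = X := by simp [rP]
  have key : gP (4 * H + 2) a * rP (4 * H + 2) a + gP (4 * H + 2) b * rP (4 * H + 2) b
      = C (4 * c + 4) * X ^ (4 * H + 2) + (C (-4) * gP H p) * X ^ 2
        + (C (-4) * rP H p) * X ^ (7 * H + 2) := by
    rw [hN, ha, hb]
    simp only [gP_cat, rP_cat, gP_neg, rP_neg, rP_rev, g1, r1]
    have e1 := gP_rev (H + H) u
    have e2 := gP_rev (H + H) v
    have e3 : ∀ Y : ℤ[X], X ^ 1 * (Y + X ^ (H + H) * (gP (H + H) (revS (H + H) u) + X ^ (H + H) * -1))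
       = X * Y + X ^ (H + H) * (rP (H + H) u - X * X ^ (H + H)) := by
      intro Y; rw [← e1]; ring
    have e4 : ∀ Y : ℤ[X], X ^ 1 * (Y + X ^ (H + H) * (-gP (H + H) (revS (H + H) v) + X ^ (H + H) * -1))
       = X * Y + X ^ (H + H) * (-rP (H + H) v - X * X ^ (H + H)) := by
      intro Y; rw [← e2]; ring
    rw [e3, e4, gu, gv, ru, rv]
    simp only [eq_intCast] at h ⊢
    push_cast
    linear_combination (4 * X ^ (3 * H + 2)) * h
  refine ⟨a, b, ?_, ?_, ?_⟩
  · rw [ha]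
    exact h1.cat _ (su.cat _ (IsSign.cat _ (IsSign.neg fun k => sv _) h1.neg))
  · rw [hb]
    exact h1.neg.cat _ (sv.cat _ (IsSign.cat _ (fun k => su _) h1.neg))
  · intro τ h1 h2
    rw [← coeff_rho, ← coeff_rho, ← coeff_add, key, coeff_add, coeff_add, coeff_C_mul_X_pow,
      if_neg (by omega), coeff_mul_X_pow', if_pos (by omega), coeff_C_mul,
      coeff_gP _ _ _ (by omega), coeff_mul_X_pow', coeff_C_mul, coeff_rP]
    by_cases h3 : 3 * H + 1 ≤ τ ∧ τ ≤ 4 * H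
    · rw [if_pos (by omega), if_pos (by omega), if_pos h3]
      have : H - (4 * H + 2 + τ - (7 * H + 2)) = 4 * H - τ := by omega
      rw [this]; ring
    · rw [if_neg h3]
      split_ifs
      · omega
      · ring
      · ring

/-- For every `m ≥ 4` there is an even-length binary Z-complementary
pair of length `N = 2^{m-1}+2` with ZCZ width `2^{m-2}+2^{m-3}+1`, whose out-of-zone
aperiodic autocorrelation sums lie in `{0, 4, -4}`. -/
theorem exists_ebzcp (m : ℕ) (hm : 4 ≤ m) :
    ∃ a b : ℕ → ℤ,
      (∀ k < 2 ^ (m - 1) + 2, a k = 1 ∨ a k = -1) ∧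
      (∀ k < 2 ^ (m - 1) + 2, b k = 1 ∨ b k = -1) ∧
      (∀ τ : ℕ, 1 ≤ τ → τ ≤ 2 ^ (m - 2) + 2 ^ (m - 3) →
        rho (2 ^ (m - 1) + 2) a τ + rho (2 ^ (m - 1) + 2) b τ = 0) ∧
      (∀ τ : ℕ, 2 ^ (m - 2) + 2 ^ (m - 3) < τ → τ ≤ 2 ^ (m - 1) + 2 - 1 →
        rho (2 ^ (m - 1) + 2) a τ + rho (2 ^ (m - 1) + 2) b τ ∈ ({0, 4, -4} : Set ℤ)) := by
  obtain ⟨n, rfl⟩ : ∃ n, m = n + 3 := ⟨m - 3, by omega⟩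
  obtain ⟨p, q, hp, hq, c, h⟩ := golay_exists n
  obtain ⟨a, b, ha, hb, H⟩ := ebzcp_core (2 ^ n) p q hp hq c h
  have e1 : 2 ^ (n + 3 - 1) = 4 * 2 ^ n := by
    rw [show n + 3 - 1 = n + 2 by omega]; ring
  have e2 : 2 ^ (n + 3 - 2) + 2 ^ (n + 3 - 3) = 3 * 2 ^ n := by
    rw [show n + 3 - 2 = n + 1 by omega, show n + 3 - 3 = n by omega]; ring
  rw [e1, e2]
  refine ⟨a, b, fun k _ => ha k, fun k _ => hb k, fun τ h1 h2 => ?_, fun τ h1 h2 => ?_⟩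
  · rw [H τ h1 (by omega), if_neg (by omega)]
  · rw [H τ (by omega) (by omega)]
    split_ifs
    · rcases hp (4 * 2 ^ n - τ) with h3 | h3 <;> simp [h3]
    · simp
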